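/- arXiv:2112.14223 — 2 statements merged into one kernel-verified Lean document; each statement's English description precedes it below -/
import Mathlib

section
/- Let h be twice continuously differentiable on [0,1] with h'(0) = h'(1) = 0. Let φ₀(x) = 1, φ_n(x) = √2·cos(nπx), λ_n = n²π², and h_n = ∫₀¹ h(x)·φ_n(x) dx for n ≥ 0. Then for every Γ > 0, every N ∈ ℕ and every x* ∈ [0,1]: ( h(x*) − Σ_{n=0}^N h_n·φ_n(x*) )² ≤ Σ_{n=N+1}^∞ (1 + Γ + λ_n/Γ)·h_n². -/
open Real MeasureTheory Set

open Filter Topology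

theorem div_one_add_sq_le_arctan_sub {a b : ℝ} (ha : 0 ≤ a) (hab : a ≤ b) :
    (b - a) / (1 + b ^ 2) ≤ arctan b - arctan a := by
  have key := (convex_Icc a b).mul_sub_le_image_sub_of_le_deriv (f := arctan)
    (C := 1 / (1 + b ^ 2)) continuous_arctan.continuousOn
    differentiable_arctan.differentiableOn
    (fun x hx => by
      rw [interior_Icc] at hx
      rw [Real.deriv_arctan]
      have : x ^ 2 ≤ b ^ 2 := pow_le_pow_left₀ (ha.trans hx.1.le) hx.2.le 2
      exact one_div_le_one_div_of_le (by positivity) (by linarith))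
    a (left_mem_Icc.2 hab) b (right_mem_Icc.2 hab) hab
  calc (b - a) / (1 + b ^ 2) = 1 / (1 + b ^ 2) * (b - a) := by ring
    _ ≤ _ := key

theorem sum_two_div_le_one {Γ : ℝ} (hΓ : 0 < Γ) (N M : ℕ) :
    ∑ n ∈ Finset.range M, 2 / (1 + Γ + ((N + 1 + n : ℕ) : ℝ) ^ 2 * π ^ 2 / Γ) ≤ 1 := by
  have hstep : ∀ n : ℕ, 2 / (1 + Γ + ((N + 1 + n : ℕ) : ℝ) ^ 2 * π ^ 2 / Γ) ≤
      2 / π * arctan ((N + (n + 1 : ℕ) : ℝ) * (π / Γ))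
        - 2 / π * arctan ((N + n : ℝ) * (π / Γ)) := by
    intro n
    have hπ := pi_pos
    have h1 := div_one_add_sq_le_arctan_sub (a := (N + n : ℝ) * (π / Γ))
      (b := (N + (n + 1 : ℕ) : ℝ) * (π / Γ)) (by positivity)
      (by push_cast; gcongr; linarith)
    rw [← mul_sub]
    refine le_trans ?_ (mul_le_mul_of_nonneg_left h1 (by positivity))
    have h2 : 2 / π * (((N + (n + 1 : ℕ) : ℝ) * (π / Γ) - (N + n : ℝ) * (π / Γ)) /
        (1 + ((N + (n + 1 : ℕ) : ℝ) * (π / Γ)) ^ 2)) =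
        2 / (Γ + ((N + 1 + n : ℕ) : ℝ) ^ 2 * π ^ 2 / Γ) := by
      push_cast
      field_simp
      ring
    rw [h2]
    gcongr
    linarith
  refine (Finset.sum_le_sum fun n _ => hstep n).trans ?_
  rw [Finset.sum_range_sub (fun n : ℕ => 2 / π * arctan ((N + n : ℝ) * (π / Γ)))]
  have hπ := pi_pos
  have h1 : 0 ≤ 2 / π * arctan ((N + (0 : ℕ) : ℝ) * (π / Γ)) := by
    have : 0 ≤ arctan ((N + (0 : ℕ) : ℝ) * (π / Γ)) := arctan_nonneg.2 (by positivity)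
    positivity
  have h2 : 2 / π * arctan ((N + M : ℝ) * (π / Γ)) ≤ 2 / π * (π / 2) := by
    gcongr
    exact (arctan_lt_pi_div_two _).le
  have h3 : 2 / π * (π / 2) = 1 := by field_simp
  linarith

/-- Cauchy–Schwarz for a convergent series, against a weighted square-summable sequence. -/
theorem HasSum.sq_le_tsum_weighted {a κ b : ℕ → ℝ} {r : ℝ} (ha : HasSum a r)
    (hκ : ∀ n, 0 < κ n) (hab : ∀ n, a n ^ 2 ≤ 2 * b n ^ 2)
    (hsum : Summable fun n => κ n * b n ^ 2)
    (hone : ∀ M, ∑ n ∈ Finset.range M, 2 / κ n ≤ 1) :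
    r ^ 2 ≤ ∑' n, κ n * b n ^ 2 := by
  refine le_of_tendsto (ha.tendsto_sum_nat.pow 2) (Eventually.of_forall fun M => ?_)
  have hnn : ∀ n, 0 ≤ κ n * b n ^ 2 := fun n => mul_nonneg (hκ n).le (sq_nonneg _)
  calc (∑ n ∈ Finset.range M, a n) ^ 2
      ≤ (∑ n ∈ Finset.range M, κ n * b n ^ 2) * ∑ n ∈ Finset.range M, 2 / κ n := by
        refine Finset.sum_sq_le_sum_mul_sum_of_sq_le_mul _ (fun n _ => hnn n)
          (fun n _ => (div_pos two_pos (hκ n)).le) fun n _ => ?_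
        have hk := (hκ n).ne'
        have : κ n * b n ^ 2 * (2 / κ n) = 2 * b n ^ 2 := by field_simp
        rw [this]
        exact hab n
    _ ≤ (∑ n ∈ Finset.range M, κ n * b n ^ 2) * 1 :=
        mul_le_mul_of_nonneg_left (hone M) (Finset.sum_nonneg fun n _ => hnn n)
    _ ≤ ∑' n, κ n * b n ^ 2 := by
        rw [mul_one]
        exact hsum.sum_le_tsum _ fun n _ => hnn n

theorem sq_mul_integral_mul_cos {h h' h'' : ℝ → ℝ}
    (hd1 : ∀ x ∈ Icc (0:ℝ) 1, HasDerivWithinAt h (h' x) (Icc 0 1) x)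
    (hd2 : ∀ x ∈ Icc (0:ℝ) 1, HasDerivWithinAt h' (h'' x) (Icc 0 1) x)
    (hcont : ContinuousOn h'' (Icc (0:ℝ) 1)) (hb0 : h' 0 = 0) (hb1 : h' 1 = 0) (n : ℕ) :
    (n * π) ^ 2 * ∫ x in (0:ℝ)..1, h x * cos (n * π * x) =
      - ∫ x in (0:ℝ)..1, h'' x * cos (n * π * x) := by
  have hh : ContinuousOn h (Icc 0 1) := fun x hx => (hd1 x hx).continuousWithinAt
  have hh' : ContinuousOn h' (Icc 0 1) := fun x hx => (hd2 x hx).continuousWithinAt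
  have i1 : IntervalIntegrable (fun x => h'' x * cos (n * π * x)) volume 0 1 :=
    ContinuousOn.intervalIntegrable_of_Icc zero_le_one (hcont.mul (by fun_prop))
  have i2 : IntervalIntegrable (fun x => (n * π) ^ 2 * (h x * cos (n * π * x))) volume 0 1 :=
    ContinuousOn.intervalIntegrable_of_Icc zero_le_one
      (continuousOn_const.mul (hh.mul (by fun_prop)))
  have key := intervalIntegral.integral_eq_sub_of_hasDerivAt_of_le (zero_le_one' ℝ)
    (f := fun x => h' x * cos (n * π * x) + n * π * (h x * sin (n * π * x)))
    (f' := fun x => h'' x * cos (n * π * x) + (n * π) ^ 2 * (h x * cos (n * π * x)))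
    ((hh'.mul (by fun_prop)).add (continuousOn_const.mul (hh.mul (by fun_prop))))
    (fun x hx => by
      have hm : Icc (0:ℝ) 1 ∈ 𝓝 x := Icc_mem_nhds hx.1 hx.2
      have e1 := (hd1 x (Ioo_subset_Icc_self hx)).hasDerivAt hm
      have e2 := (hd2 x (Ioo_subset_Icc_self hx)).hasDerivAt hm
      have e0 : HasDerivAt (fun x : ℝ => n * π * x) (n * π) x := by
        simpa using (hasDerivAt_id x).const_mul (n * π)
      convert! (e2.mul e0.cos).add ((e1.mul e0.sin).const_mul (n * π)) using 1
      ring)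
    (i1.add i2)
  rw [intervalIntegral.integral_add i1 i2, intervalIntegral.integral_const_mul] at key
  simp only [hb0, hb1, mul_one, mul_zero, sin_nat_mul_pi, sin_zero, zero_mul, add_zero,
    sub_zero] at key
  linarith

theorem exists_sq_mul_abs_integral_mul_cos_le {h h' h'' : ℝ → ℝ}
    (hd1 : ∀ x ∈ Icc (0:ℝ) 1, HasDerivWithinAt h (h' x) (Icc 0 1) x)
    (hd2 : ∀ x ∈ Icc (0:ℝ) 1, HasDerivWithinAt h' (h'' x) (Icc 0 1) x)
    (hcont : ContinuousOn h'' (Icc (0:ℝ) 1)) (hb0 : h' 0 = 0) (hb1 : h' 1 = 0) :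
    ∃ C : ℝ, ∀ n : ℕ, (n * π) ^ 2 * |∫ x in (0:ℝ)..1, h x * cos (n * π * x)| ≤ C := by
  obtain ⟨C, hC⟩ := isCompact_Icc.exists_bound_of_continuousOn hcont
  refine ⟨C, fun n => ?_⟩
  rw [← abs_of_nonneg (sq_nonneg ((n : ℝ) * π)), ← abs_mul,
    sq_mul_integral_mul_cos hd1 hd2 hcont hb0 hb1, abs_neg]
  have := intervalIntegral.norm_integral_le_of_norm_le_const (a := 0) (b := 1) (C := C)
    (f := fun x => h'' x * cos (n * π * x)) (fun x hx => by
      rw [uIoc_of_le zero_le_one] at hx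
      rw [norm_mul]
      have h1 := hC x (Ioc_subset_Icc_self hx)
      have h2 : ‖cos (n * π * x)‖ ≤ 1 := abs_cos_le_one _
      nlinarith [norm_nonneg (h'' x)])
  simpa using this

theorem fourierCoeff_liftIco_abs [Fact ((0:ℝ) < 2)] {h : ℝ → ℝ} (hh : ContinuousOn h (Icc 0 1))
    (n : ℤ) :
    fourierCoeff (AddCircle.liftIco 2 (-1) fun x : ℝ => ((h |x| : ℝ) : ℂ)) n =
      ((∫ x in (0:ℝ)..1, h x * cos (n * π * x) : ℝ) : ℂ) := by
  rw [fourierCoeff_eq_intervalIntegral _ _ (-1)]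
  have habs : ContinuousOn (fun x : ℝ => h |x|) (Icc (-1) 1) :=
    hh.comp continuous_abs.continuousOn fun x hx => ⟨abs_nonneg x, abs_le.2 hx⟩
  have e1 : ∫ x in (-1:ℝ)..-1 + 2, @fourier 2 (-n) x •
      AddCircle.liftIco 2 (-1) (fun x : ℝ => ((h |x| : ℝ) : ℂ)) x =
      ∫ x in (-1:ℝ)..1, Complex.exp (-(n * π * x * Complex.I)) * (h |x| : ℝ) := by
    rw [show (-1:ℝ) + 2 = 1 by norm_num]
    refine intervalIntegral.integral_congr_Ioo_of_le (by norm_num) fun x hx => ?_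
    have hx' : x ∈ Ico (-1:ℝ) (-1 + 2) := ⟨hx.1.le, by linarith [hx.2]⟩
    simp only [AddCircle.liftIco_coe_apply hx', fourier_coe_apply, smul_eq_mul]
    congr 2
    push_cast
    ring
  have hc : ContinuousOn
      (fun x : ℝ => Complex.exp (-(n * π * x * Complex.I)) * ((h |x| : ℝ) : ℂ)) (Icc (-1) 1) :=
    ContinuousOn.mul (by fun_prop) (Complex.continuous_ofReal.comp_continuousOn habs)
  have i1 := (hc.mono (Icc_subset_Icc_right zero_le_one)).intervalIntegrable_of_Icc
    (μ := volume) (by norm_num)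
  have i2 := (hc.mono (Icc_subset_Icc_left (by norm_num : (-1:ℝ) ≤ 0))).intervalIntegrable_of_Icc
    (μ := volume) zero_le_one
  have i3 : IntervalIntegrable
      (fun x : ℝ => Complex.exp (-(n * π * (-x : ℝ) * Complex.I)) * ((h |-x| : ℝ) : ℂ))
      volume 0 1 := by
    simpa using ((IntervalIntegrable.iff_comp_neg).1 i1).symm
  rw [e1, ← intervalIntegral.integral_add_adjacent_intervals i1 i2]
  have e2 := intervalIntegral.integral_comp_neg (a := 0) (b := 1)
    (fun x : ℝ => Complex.exp (-(n * π * x * Complex.I)) * ((h |x| : ℝ) : ℂ))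
  rw [neg_zero] at e2
  rw [← e2, ← intervalIntegral.integral_add i3 i2, ← intervalIntegral.integral_ofReal,
    ← intervalIntegral.integral_smul]
  refine intervalIntegral.integral_congr fun x hx => ?_
  rw [uIcc_of_le zero_le_one] at hx
  simp only [abs_neg, abs_of_nonneg hx.1, Complex.real_smul]
  push_cast
  rw [Complex.cos]
  ring_nf

theorem hasSum_cosine_series {h : ℝ → ℝ} (hh : ContinuousOn h (Icc 0 1)) {d : ℕ → ℝ}
    (hd : ∀ n, d n = ∫ x in (0:ℝ)..1, h x * cos (n * π * x)) (hs : Summable d)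
    {x : ℝ} (hx : x ∈ Icc (0:ℝ) 1) :
    HasSum (fun n : ℕ => 2 * d n * cos (n * π * x)) (h x + d 0) := by
  have : Fact ((0:ℝ) < 2) := ⟨two_pos⟩
  have habs : ContinuousOn (fun x : ℝ => h |x|) (Icc (-1) 1) :=
    hh.comp continuous_abs.continuousOn fun x hx => ⟨abs_nonneg x, abs_le.2 hx⟩
  let F : C(AddCircle (2:ℝ), ℂ) :=
    ⟨AddCircle.liftIco 2 (-1) fun x : ℝ => ((h |x| : ℝ) : ℂ),
      AddCircle.liftIco_continuous (by norm_num) (by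
        rw [show (-1:ℝ) + 2 = 1 by norm_num]
        exact Complex.continuous_ofReal.comp_continuousOn habs)⟩
  have hpos : ∀ n : ℕ, fourierCoeff F (n : ℤ) = (d n : ℂ) := fun n => by
    rw [hd]
    exact fourierCoeff_liftIco_abs hh n
  have hneg : ∀ n : ℕ, fourierCoeff F (-(n : ℤ)) = (d n : ℂ) := fun n => by
    rw [hd]
    refine (fourierCoeff_liftIco_abs hh (-(n : ℤ))).trans ?_
    simp
  have hsC : Summable fun n => (d n : ℂ) := Complex.summable_ofReal.2 hs
  have hsum : Summable (fourierCoeff F) :=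
    Summable.of_nat_of_neg (by simpa only [hpos] using hsC) (by simpa only [hneg] using hsC)
  have key := (has_pointwise_sum_fourier_series_of_summable hsum
    ((-x : ℝ) : AddCircle (2:ℝ))).nat_add_neg
  have hF : F ((-x : ℝ) : AddCircle (2:ℝ)) = (h x : ℂ) := by
    have hx' : -x ∈ Ico (-1:ℝ) (-1 + 2) := ⟨by linarith [hx.2], by linarith [hx.1]⟩
    change AddCircle.liftIco 2 (-1) (fun x : ℝ => ((h |x| : ℝ) : ℂ)) _ = _
    rw [AddCircle.liftIco_coe_apply hx', abs_neg, abs_of_nonneg hx.1]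
  have h0 : fourierCoeff F 0 = (d 0 : ℂ) := by simpa using hpos 0
  simp only [hpos, hneg, hF, h0, fourier_coe_apply, smul_eq_mul] at key
  rw [← Complex.hasSum_ofReal]
  convert! key using 1
  · funext n
    push_cast
    rw [Complex.cos]
    ring_nf
  · simp

/-- Residual bound for the truncated Fourier cosine expansion: for `h` twice
continuously differentiable on `[0,1]` with `h'(0) = h'(1) = 0`, coefficients
`hₙ = ∫₀¹ h·φₙ` (with `φ₀ = 1`, `φₙ(x) = √2 cos(nπx)`, `λₙ = n²π²`), every
`Γ > 0`, `N ∈ ℕ` and `x* ∈ [0,1]`: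
`(h(x*) − Σ_{n=0}^N hₙ φₙ(x*))² ≤ Σ_{n=N+1}^∞ (1 + Γ + λₙ/Γ)·hₙ²`. -/
theorem truncation_residual_bound (h h' h'' : ℝ → ℝ)
    (hd1 : ∀ x ∈ Icc (0:ℝ) 1, HasDerivWithinAt h (h' x) (Icc 0 1) x)
    (hd2 : ∀ x ∈ Icc (0:ℝ) 1, HasDerivWithinAt h' (h'' x) (Icc 0 1) x)
    (hcont : ContinuousOn h'' (Icc (0:ℝ) 1))
    (hb0 : h' 0 = 0) (hb1 : h' 1 = 0)
    (φ : ℕ → ℝ → ℝ)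
    (hφ0 : ∀ x : ℝ, φ 0 x = 1)
    (hφn : ∀ n : ℕ, 1 ≤ n → ∀ x : ℝ, φ n x = Real.sqrt 2 * Real.cos (n * π * x))
    (lam : ℕ → ℝ) (hlam : ∀ n : ℕ, lam n = (n:ℝ) ^ 2 * π ^ 2)
    (c : ℕ → ℝ) (hc : ∀ n : ℕ, c n = ∫ x in (0:ℝ)..1, h x * φ n x)
    (Γ : ℝ) (hΓ : 0 < Γ) (N : ℕ) (xs : ℝ) (hxs : xs ∈ Icc (0:ℝ) 1) :
    (h xs - ∑ n ∈ Finset.range (N + 1), c n * φ n xs) ^ 2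
      ≤ ∑' n : ℕ, (1 + Γ + lam (N + 1 + n) / Γ) * (c (N + 1 + n)) ^ 2 := by
  have hh : ContinuousOn h (Icc 0 1) := fun x hx => (hd1 x hx).continuousWithinAt
  obtain ⟨C, hC⟩ := exists_sq_mul_abs_integral_mul_cos_le hd1 hd2 hcont hb0 hb1
  set d : ℕ → ℝ := fun n => ∫ x in (0:ℝ)..1, h x * cos (n * π * x) with hd
  have hπ := pi_pos
  have hdC : ∀ n : ℕ, ((n:ℝ) * π) ^ 2 * |d n| ≤ C := hC
  have hbound : ∀ n : ℕ, 1 ≤ n → |d n| ≤ C / π ^ 2 * (1 / (n:ℝ) ^ 2) := fun n hn => by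
    have hn' : (0:ℝ) < n := by exact_mod_cast hn
    have e : C / π ^ 2 * (1 / (n:ℝ) ^ 2) = C / ((n:ℝ) * π) ^ 2 := by field_simp
    rw [e, le_div_iff₀ (by positivity)]
    linarith [hdC n]
  have hsq : Summable fun n : ℕ => C / π ^ 2 * (1 / (n:ℝ) ^ 2) :=
    (summable_one_div_nat_pow.2 one_lt_two).mul_left _
  have hs : Summable d := by
    rw [← summable_nat_add_iff 1]
    refine Summable.of_norm_bounded ((summable_nat_add_iff 1).2 hsq) fun n => ?_
    exact hbound (n + 1) (by omega)
  have hcd : ∀ n, 1 ≤ n → c n = √2 * d n := fun n hn => by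
    rw [hc, hd, ← intervalIntegral.integral_const_mul]
    refine intervalIntegral.integral_congr fun x _ => ?_
    simp only [hφn n hn]
    ring
  have hc0 : c 0 = d 0 := by simp [hc, hd, hφ0]
  have h2 : √2 * √2 = (2:ℝ) := mul_self_sqrt zero_le_two
  have hseries : HasSum (fun n => c n * φ n xs) (h xs) := by
    have key := hasSum_cosine_series hh (d := d) (fun _ => rfl) hs hxs
    rw [← hasSum_nat_add_iff' 1] at key ⊢
    convert! key using 1
    · funext n
      rw [hcd _ (by omega), hφn _ (by omega)]
      linear_combination d (n + 1) * cos ((n + 1 : ℕ) * π * xs) * h2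
    · simp [hc0, hφ0]
      ring
  have htail : HasSum (fun n => c (N + 1 + n) * φ (N + 1 + n) xs)
      (h xs - ∑ n ∈ Finset.range (N + 1), c n * φ n xs) := by
    simpa only [add_comm] using (hasSum_nat_add_iff' (N + 1)).2 hseries
  refine htail.sq_le_tsum_weighted (κ := fun n => 1 + Γ + lam (N + 1 + n) / Γ)
    (fun n => by rw [hlam]; positivity) (fun n => ?_) ?_ (fun M => ?_)
  · rw [hφn _ (by omega)]
    have hcos := cos_sq_le_one ((N + 1 + n : ℕ) * π * xs)
    calc (c (N + 1 + n) * (√2 * cos ((N + 1 + n : ℕ) * π * xs))) ^ 2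
        = 2 * c (N + 1 + n) ^ 2 * cos ((N + 1 + n : ℕ) * π * xs) ^ 2 := by
          linear_combination c (N + 1 + n) ^ 2 * cos ((N + 1 + n : ℕ) * π * xs) ^ 2 * h2
      _ ≤ 2 * c (N + 1 + n) ^ 2 * 1 := by gcongr
      _ = _ := mul_one _
  · have hdom : Summable fun n : ℕ =>
        2 * ((1 + Γ) * C / π ^ 2 + C / Γ) * (C / π ^ 2 * (1 / ((N + 1 + n : ℕ):ℝ) ^ 2)) := by
      have := ((summable_nat_add_iff (N + 1)).2 hsq).mul_left (2 * ((1 + Γ) * C / π ^ 2 + C / Γ))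
      simpa only [add_comm] using this
    refine Summable.of_nonneg_of_le (fun n => by rw [hlam]; positivity) (fun n => ?_) hdom
    have hn : 1 ≤ N + 1 + n := by omega
    generalize N + 1 + n = m at hn
    have hm : (1:ℝ) ≤ m := by exact_mod_cast hn
    have hC0 : 0 ≤ C := le_trans (by positivity) (hdC m)
    have hb := hbound m hn
    have hb' : |d m| ≤ C / π ^ 2 := hb.trans (mul_le_of_le_one_right (by positivity)
      ((div_le_one (by positivity)).2 (one_le_pow₀ hm)))
    have hl : (1 + Γ + lam m / Γ) * |d m| ≤ (1 + Γ) * C / π ^ 2 + C / Γ := by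
      have e1 : (1 + Γ) * |d m| ≤ (1 + Γ) * (C / π ^ 2) := by gcongr
      have e2 : ((m:ℝ) * π) ^ 2 * |d m| / Γ ≤ C / Γ := by
        gcongr
        exact hdC m
      calc (1 + Γ + lam m / Γ) * |d m|
          = (1 + Γ) * |d m| + ((m:ℝ) * π) ^ 2 * |d m| / Γ := by rw [hlam]; ring
        _ ≤ (1 + Γ) * (C / π ^ 2) + C / Γ := add_le_add e1 e2
        _ = _ := by ring
    calc (1 + Γ + lam m / Γ) * c m ^ 2
        = 2 * ((1 + Γ + lam m / Γ) * |d m|) * |d m| := by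
          rw [hcd m hn]
          linear_combination (1 + Γ + lam m / Γ) * d m ^ 2 * h2
            - 2 * (1 + Γ + lam m / Γ) * sq_abs (d m)
      _ ≤ _ := by gcongr
  · simpa only [hlam] using sum_two_div_le_one hΓ N M
end

section
/- Let f : ℝ → ℝ^k be continuous, let δ ≥ 0, τ > 0, t ∈ ℝ, and let R ∈ ℝ^{k×k} be symmetric positive semidefinite. Then (∫_{t−τ}^{t} f(s) ds)ᵀ · R · (∫_{t−τ}^{t} f(s) ds) ≤ τ·e^{2δτ}·∫_{t−τ}^{t} e^{−2δ(t−s)}·f(s)ᵀ R f(s) ds. -/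
open Real MeasureTheory Matrix

theorem intervalIntegral_dotProduct_const {n : Type*} [Fintype n] {f : ℝ → n → ℝ} {a b : ℝ}
    (hf : IntervalIntegrable f volume a b) (v : n → ℝ) :
    ∫ s in a..b, v ⬝ᵥ f s = v ⬝ᵥ ∫ s in a..b, f s :=
  (LinearMap.toContinuousLinearMap (dotProductBilin ℝ ℝ v)).intervalIntegral_comp_comm hf

/-- Young's inequality for the quadratic form of a positive semidefinite matrix. -/
theorem Matrix.PosSemidef.two_mul_dotProduct_mulVec_le {n : Type*} [Fintype n]
    {R : Matrix n n ℝ} (hR : R.PosSemidef) (c : ℝ) (x y : n → ℝ) :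
    2 * c * (x ⬝ᵥ R *ᵥ y) ≤ c ^ 2 * (y ⬝ᵥ R *ᵥ y) + x ⬝ᵥ R *ᵥ x := by
  have hcomm : y ⬝ᵥ R *ᵥ x = x ⬝ᵥ R *ᵥ y := by
    have hT : Rᵀ = R := by simpa using hR.isHermitian.eq
    rw [dotProduct_mulVec, ← mulVec_transpose, hT, dotProduct_comm]
  have hnonneg := hR.dotProduct_mulVec_nonneg (c • y - x)
  simp only [star_trivial, mulVec_sub, mulVec_smul, sub_dotProduct, dotProduct_sub,
    smul_dotProduct, dotProduct_smul, smul_eq_mul, hcomm] at hnonneg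
  linarith

/-- Jensen's inequality for the quadratic form of a positive semidefinite matrix. -/
theorem Matrix.PosSemidef.jensen_intervalIntegral {n : Type*} [Fintype n]
    {R : Matrix n n ℝ} (hR : R.PosSemidef) {f : ℝ → n → ℝ} (hf : Continuous f)
    {a b : ℝ} (hab : a < b) :
    (∫ s in a..b, f s) ⬝ᵥ R *ᵥ (∫ s in a..b, f s)
      ≤ (b - a) * ∫ s in a..b, f s ⬝ᵥ R *ᵥ f s := by
  set x := ∫ s in a..b, f s with hx
  have hcross : ∫ s in a..b, x ⬝ᵥ R *ᵥ f s = x ⬝ᵥ R *ᵥ x := by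
    simp only [dotProduct_mulVec]
    exact intervalIntegral_dotProduct_const (hf.intervalIntegrable a b) _
  have hcont : Continuous fun s => f s ⬝ᵥ R *ᵥ f s := by fun_prop
  have hmono := intervalIntegral.integral_mono_on (μ := volume) hab.le
    (f := fun s => 2 * (b - a) * (x ⬝ᵥ R *ᵥ f s))
    (g := fun s => (b - a) ^ 2 * (f s ⬝ᵥ R *ᵥ f s) + x ⬝ᵥ R *ᵥ x)
    (Continuous.intervalIntegrable (by fun_prop) a b)
    (Continuous.intervalIntegrable (by fun_prop) a b)
    fun s _ => hR.two_mul_dotProduct_mulVec_le (b - a) x (f s)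
  rw [intervalIntegral.integral_const_mul, hcross,
    intervalIntegral.integral_add ((hcont.const_mul _).intervalIntegrable a b)
      intervalIntegrable_const,
    intervalIntegral.integral_const_mul, intervalIntegral.integral_const, smul_eq_mul] at hmono
  refine le_of_mul_le_mul_left ?_ (sub_pos.2 hab)
  linarith

/-- Exponentially weighted Jensen inequality: for continuous `f : ℝ → ℝᵏ`,
`δ ≥ 0`, `τ > 0` and symmetric positive semidefinite `R`,
`(∫_{t−τ}^t f)ᵀ R (∫_{t−τ}^t f) ≤ τ e^{2δτ} ∫_{t−τ}^t e^{−2δ(t−s)} f(s)ᵀ R f(s) ds`. -/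
theorem weighted_jensen_quadratic (k : ℕ) (f : ℝ → (Fin k → ℝ))
    (hf : Continuous f) (δ τ t : ℝ) (hδ : 0 ≤ δ) (hτ : 0 < τ)
    (R : Matrix (Fin k) (Fin k) ℝ) (hsymm : R.IsSymm) (hR : R.PosSemidef) :
    (∫ s in (t - τ)..t, f s) ⬝ᵥ R.mulVec (∫ s in (t - τ)..t, f s)
      ≤ τ * Real.exp (2 * δ * τ) *
        ∫ s in (t - τ)..t, Real.exp (-2 * δ * (t - s)) * (f s ⬝ᵥ R.mulVec (f s)) := by
  have hjensen := hR.jensen_intervalIntegral hf (sub_lt_self t hτ)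
  rw [sub_sub_cancel] at hjensen
  refine hjensen.trans ?_
  rw [mul_assoc, ← intervalIntegral.integral_const_mul (Real.exp (2 * δ * τ))]
  refine mul_le_mul_of_nonneg_left ?_ hτ.le
  refine intervalIntegral.integral_mono_on (sub_le_self t hτ.le)
    (Continuous.intervalIntegrable (by fun_prop) _ _)
    (Continuous.intervalIntegrable (by fun_prop) _ _) fun s hs => ?_
  rw [← mul_assoc, ← Real.exp_add]
  have hquad : 0 ≤ f s ⬝ᵥ R *ᵥ f s := by simpa using hR.dotProduct_mulVec_nonneg (f s)
  have hexp : 0 ≤ 2 * δ * τ + -2 * δ * (t - s) := by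
    linarith [mul_nonneg hδ (sub_nonneg.2 hs.1)]
  exact le_mul_of_one_le_left hquad (Real.one_le_exp hexp)
end
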